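/- Let r : ℕ → ℝ be a positive function with r(n)·n^{2/3} → 0 as n → ∞. Then the probability that no two edges of the random geometric graph G(n, r(n)) cross (i.e., that G(n, r(n)) is plane) tends to 1 as n → ∞. -/

import Mathlib

open MeasureTheory Filter

noncomputable section

/-- The unit square `[0,1]²` in the Euclidean plane. -/
def unitSquare : Set (EuclideanSpace ℝ (Fin 2)) := {x | ∀ i, x i ∈ Set.Icc (0 : ℝ) 1}

/-- The distribution of `n` independent uniform points in the unit square. -/
def sqMeasure (n : ℕ) : Measure (Fin n → EuclideanSpace ℝ (Fin 2)) :=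
  Measure.pi fun _ => volume.restrict unitSquare

/-- The random geometric graph on `n` points `x 0, …, x (n-1)` with distance parameter `r`:
distinct `i`, `j` are adjacent iff `dist (x i) (x j) ≤ r`. -/
def geomGraph (n : ℕ) (r : ℝ) (x : Fin n → EuclideanSpace ℝ (Fin 2)) : SimpleGraph (Fin n) where
  Adj i j := i ≠ j ∧ dist (x i) (x j) ≤ r
  symm := ⟨fun i j h => ⟨h.1.symm, by rw [dist_comm]; exact h.2⟩⟩
  loopless := ⟨fun i h => h.1 rfl⟩

/-- Two segments `[a,b]` and `[c,d]` cross if they have a common point that is interior to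
both segments, i.e. lies on each segment and is distinct from its endpoints. -/
def Crosses (a b c d : EuclideanSpace ℝ (Fin 2)) : Prop :=
  ∃ p, (p ∈ segment ℝ a b ∧ p ≠ a ∧ p ≠ b) ∧ (p ∈ segment ℝ c d ∧ p ≠ c ∧ p ≠ d)

/-- The (straight-line drawing of the) random geometric graph has two crossing edges. -/
def HasCrossing (n : ℕ) (r : ℝ) (x : Fin n → EuclideanSpace ℝ (Fin 2)) : Prop :=
  ∃ i j k l : Fin n, (geomGraph n r x).Adj i j ∧ (geomGraph n r x).Adj k l ∧
    ({i, j} : Finset (Fin n)) ≠ {k, l} ∧ Crosses (x i) (x j) (x k) (x l)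

abbrev E2 := EuclideanSpace ℝ (Fin 2)

abbrev sqν : Measure E2 := volume.restrict unitSquare

lemma meas_unitSquare : volume unitSquare = 1 := by
  have h : unitSquare = (@WithLp.ofLp 2 (Fin 2 → ℝ)) ⁻¹' (Set.univ.pi fun _ => Set.Icc (0:ℝ) 1) := by
    ext x; simp only [unitSquare, Set.mem_preimage, Set.mem_univ_pi]; rfl
  rw [h, (PiLp.volume_preserving_ofLp (Fin 2)).measure_preimage
    (MeasurableSet.univ_pi fun _ => measurableSet_Icc).nullMeasurableSet, volume_pi_pi]
  simp

instance sqν_prob : IsProbabilityMeasure sqν := ⟨by simp [meas_unitSquare]⟩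

lemma sqMeasure_map {m n : ℕ} (f : Fin m → Fin n) (hf : Function.Injective f) :
    (sqMeasure n).map (fun x i => x (f i)) = sqMeasure m := by
  have h0 : ProbabilityTheory.iIndepFun (fun (i : Fin n) (x : Fin n → E2) => x i)
      (Measure.pi fun _ : Fin n => sqν) :=
    ProbabilityTheory.iIndepFun_pi (X := fun _ => id) (fun i => aemeasurable_id)
  have h1 := (ProbabilityTheory.iIndepFun_iff_map_fun_eq_pi_map
    (fun i => (measurable_pi_apply (f i)).aemeasurable)).1 (h0.precomp hf)
  unfold sqMeasure
  rw [h1]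
  congr 1
  ext1 i
  exact (measurePreserving_eval (fun _ : Fin n => sqν) (f i)).map_eq

lemma sqMeasure_pre {m n : ℕ} (f : Fin m → Fin n) (hf : Function.Injective f)
    {S : Set (Fin m → E2)} (hS : MeasurableSet S) :
    sqMeasure n {x | (fun i => x (f i)) ∈ S} = sqMeasure m S := by
  rw [← sqMeasure_map f hf, Measure.map_apply _ hS]
  · rfl
  · fun_prop

def S4 (r : ℝ) : Set (Fin 4 → E2) := {x | ∀ j : Fin 3, dist (x j.succ) (x 0) ≤ 2 * r}

def S3 : Set (Fin 3 → E2) := {x | x 1 ≠ x 2 ∧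
  (x 2 0 - x 1 0) * (x 0 1 - x 1 1) = (x 2 1 - x 1 1) * (x 0 0 - x 1 0)}

lemma S4_meas (r : ℝ) : MeasurableSet (S4 r) := by
  apply IsClosed.measurableSet
  unfold S4
  rw [Set.setOf_forall]
  refine isClosed_iInter fun j => isClosed_le (by fun_prop) (by fun_prop)

lemma S3_meas : MeasurableSet S3 := by
  unfold S3
  apply MeasurableSet.inter
  · exact (isClosed_eq (by fun_prop) (by fun_prop) :
      IsClosed {x : Fin 3 → E2 | x 1 = x 2}).measurableSet.compl
  · exact (isClosed_eq (by fun_prop) (by fun_prop)).measurableSet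

lemma S4_bound (r : ℝ) :
    sqMeasure 4 (S4 r) ≤ (ENNReal.ofReal (2 * r) ^ 2 * ENNReal.ofReal Real.pi) ^ 3 := by
  let T : Set (E2 × (Fin 3 → E2)) := {p | ∀ j, dist (p.2 j) p.1 ≤ 2 * r}
  have hT : MeasurableSet T := by
    apply IsClosed.measurableSet
    simp only [T, Set.setOf_forall]
    refine isClosed_iInter fun j => isClosed_le (by fun_prop) (by fun_prop)
  have hmp := measurePreserving_piFinSuccAbove (fun _ : Fin 4 => sqν) 0
  have hpre : S4 r = (MeasurableEquiv.piFinSuccAbove (fun _ : Fin 4 => E2) 0) ⁻¹' T := by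
    ext x
    rfl
  unfold sqMeasure
  rw [hpre, hmp.measure_preimage hT.nullMeasurableSet, Measure.prod_apply hT]
  calc _ ≤ ∫⁻ x : E2, (ENNReal.ofReal (2 * r) ^ 2 * ENNReal.ofReal Real.pi) ^ 3 ∂sqν := by
        apply lintegral_mono
        intro x
        have : Prod.mk x ⁻¹' T = Set.univ.pi fun _ : Fin 3 => Metric.closedBall x (2 * r) := by
          ext y; simp [T]
        simp only
        rw [this, Measure.pi_pi]
        calc _ ≤ ∏ i : Fin 3, (ENNReal.ofReal (2 * r) ^ 2 * ENNReal.ofReal Real.pi) := by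
              apply Finset.prod_le_prod' 
              intro i _
              rw [← EuclideanSpace.volume_closedBall_fin_two x]
              exact Measure.restrict_apply_le _ _
          _ = _ := by simp
    _ = _ := by simp

lemma line_null (a b : E2) (hab : a ≠ b) :
    volume {c : E2 | (b 0 - a 0) * (c 1 - a 1) = (b 1 - a 1) * (c 0 - a 0)} = 0 := by
  let s : Submodule ℝ E2 :=
    { carrier := {v | (b 0 - a 0) * v 1 = (b 1 - a 1) * v 0}
      add_mem' := by
        intro u v hu hv
        simp only [Set.mem_setOf_eq, PiLp.add_apply] at *
        linarith
      zero_mem' := by simp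
      smul_mem' := by
        intro t v hv
        simp only [Set.mem_setOf_eq, PiLp.smul_apply, smul_eq_mul] at *
        linear_combination t * hv }
  have hs : s ≠ ⊤ := by
    intro h
    apply hab
    have h1 : (!₂[1, 0] : E2) ∈ s := by rw [h]; trivial
    have h2 : (!₂[0, 1] : E2) ∈ s := by rw [h]; trivial
    change (b 0 - a 0) * _ = (b 1 - a 1) * _ at h1
    change (b 0 - a 0) * _ = (b 1 - a 1) * _ at h2
    simp at h1 h2
    ext i
    fin_cases i
    · simp; linarith
    · simp; linarith
  have h := Measure.addHaar_submodule (volume : Measure E2) s hs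
  rw [← measure_preimage_add_right volume (-a)] at h
  convert h using 2
  ext c
  change _ ↔ (b 0 - a 0) * (c + -a) 1 = (b 1 - a 1) * (c + -a) 0
  simp [sub_eq_add_neg]

lemma S3_null : sqMeasure 3 S3 = 0 := by
  let T : Set (E2 × (Fin 2 → E2)) := {p | p.2 0 ≠ p.2 1 ∧
    (p.2 1 0 - p.2 0 0) * (p.1 1 - p.2 0 1) = (p.2 1 1 - p.2 0 1) * (p.1 0 - p.2 0 0)}
  have hT : MeasurableSet T := by
    apply MeasurableSet.inter
    · exact (isClosed_eq (by fun_prop) (by fun_prop) :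
        IsClosed {p : E2 × (Fin 2 → E2) | p.2 0 = p.2 1}).measurableSet.compl
    · exact (isClosed_eq (by fun_prop) (by fun_prop)).measurableSet
  have hmp := measurePreserving_piFinSuccAbove (fun _ : Fin 3 => sqν) 0
  have hpre : S3 = (MeasurableEquiv.piFinSuccAbove (fun _ : Fin 3 => E2) 0) ⁻¹' T := by
    ext x
    rfl
  unfold sqMeasure
  rw [hpre, hmp.measure_preimage hT.nullMeasurableSet, Measure.prod_apply_symm hT]
  rw [← lintegral_zero]
  congr 1
  ext1 y
  by_cases h : y 0 = y 1
  · have : (fun x : E2 => (x, y)) ⁻¹' T = ∅ := by ext x; simp [T, h]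
    rw [this]; simp
  · refine le_antisymm ?_ zero_le
    refine (Measure.restrict_apply_le _ _).trans ?_
    rw [← line_null _ _ h]
    exact measure_mono fun x hx => hx.2

lemma crosses_share {a b d : E2} (h : Crosses a b a d) :
    a ≠ b ∧ (b 0 - a 0) * (d 1 - a 1) = (b 1 - a 1) * (d 0 - a 0) := by
  obtain ⟨p, ⟨h1, h2, h3⟩, h4, h5, h6⟩ := h
  refine ⟨?_, ?_⟩
  · rintro rfl
    simp at h1
    exact h2 h1
  rw [segment_eq_image'] at h1 h4
  obtain ⟨t, ht, rfl⟩ := h1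
  obtain ⟨s, hs, hst⟩ := h4
  have ht0 : t ≠ 0 := by rintro rfl; simp at h2
  have hs0 : s ≠ 0 := by rintro rfl; simp at hst; simp_all
  have e0 := congrArg (fun v : E2 => v 0) hst
  have e1 := congrArg (fun v : E2 => v 1) hst
  simp at e0 e1
  apply mul_left_cancel₀ hs0
  linear_combination (b 0 - a 0) * e1 - (b 1 - a 1) * e0

lemma Crosses.swapL {a b c d : E2} (h : Crosses a b c d) : Crosses b a c d := by
  obtain ⟨p, ⟨h1, h2, h3⟩, h4⟩ := h
  exact ⟨p, ⟨by rwa [segment_symm], h3, h2⟩, h4⟩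

lemma Crosses.swapR {a b c d : E2} (h : Crosses a b c d) : Crosses a b d c := by
  obtain ⟨p, h4, h1, h2, h3⟩ := h
  exact ⟨p, h4, by rwa [segment_symm], h3, h2⟩

lemma crosses_dist {a b c d : E2} {r : ℝ} (h : Crosses a b c d) (hab : dist a b ≤ r)
    (hcd : dist c d ≤ r) : dist b a ≤ 2 * r ∧ dist c a ≤ 2 * r ∧ dist d a ≤ 2 * r := by
  obtain ⟨p, ⟨h1, -, -⟩, h4, -, -⟩ := h
  have e1 := dist_add_dist_of_mem_segment h1
  have e2 := dist_add_dist_of_mem_segment h4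
  have := dist_triangle c p a
  have := dist_triangle d p a
  have := dist_comm d p
  have := dist_comm p a
  have := dist_comm b a
  have := @dist_nonneg _ _ a b
  have := @dist_nonneg _ _ a p
  have := @dist_nonneg _ _ p b
  have := @dist_nonneg _ _ c p
  have := @dist_nonneg _ _ p d
  refine ⟨by linarith, by linarith, by linarith⟩

lemma share_mem {n : ℕ} {x : Fin n → E2} {i j l : Fin n} (hij : i ≠ j) (hil : i ≠ l)
    (hjl : j ≠ l) (h : Crosses (x i) (x j) (x i) (x l)) :
    ∃ g : Fin 3 → Fin n, Function.Injective g ∧ (fun t => x (g t)) ∈ S3 := by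
  refine ⟨![l, i, j], ?_, ?_⟩
  · intro u v huv
    fin_cases u <;> fin_cases v <;> simp_all
  · exact crosses_share h

lemma hasCrossing_mem {n : ℕ} {r : ℝ} {x : Fin n → E2} (h : HasCrossing n r x) :
    (∃ g : Fin 4 → Fin n, Function.Injective g ∧ (fun t => x (g t)) ∈ S4 r) ∨
    (∃ g : Fin 3 → Fin n, Function.Injective g ∧ (fun t => x (g t)) ∈ S3) := by
  obtain ⟨i, j, k, l, ⟨hij, dij⟩, ⟨hkl, dkl⟩, hne, hc⟩ := h
  by_cases hik : i = k
  · subst hik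
    have hjl : j ≠ l := by rintro rfl; exact hne rfl
    exact Or.inr (share_mem hij hkl hjl hc)
  by_cases hil : i = l
  · subst hil
    have hjl : j ≠ k := by rintro rfl; exact hne (Finset.pair_comm _ _)
    exact Or.inr (share_mem hij hik hjl hc.swapR)
  by_cases hjk : j = k
  · subst hjk
    exact Or.inr (share_mem hij.symm hkl hil hc.swapL)
  by_cases hjl : j = l
  · subst hjl
    exact Or.inr (share_mem hij.symm hjk hik hc.swapL.swapR)
  left
  obtain ⟨h1, h2, h3⟩ := crosses_dist hc dij dkl
  refine ⟨![i, j, k, l], ?_, ?_⟩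
  · intro u v huv
    fin_cases u <;> fin_cases v <;> simp_all
  · intro t
    fin_cases t
    · exact h1
    · exact h2
    · exact h3

lemma bad_bound (n : ℕ) (r : ℝ) : sqMeasure n {x | HasCrossing n r x} ≤
    (n : ENNReal) ^ 4 * (ENNReal.ofReal (2 * r) ^ 2 * ENNReal.ofReal Real.pi) ^ 3 := by
  have hsub : {x | HasCrossing n r x} ⊆
      (⋃ g : Fin 4 → Fin n, {x | Function.Injective g ∧ (fun t => x (g t)) ∈ S4 r}) ∪
      (⋃ g : Fin 3 → Fin n, {x | Function.Injective g ∧ (fun t => x (g t)) ∈ S3}) := by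
    intro x hx
    rcases hasCrossing_mem hx with ⟨g, hg⟩ | ⟨g, hg⟩
    · exact Or.inl (Set.mem_iUnion.2 ⟨g, hg⟩)
    · exact Or.inr (Set.mem_iUnion.2 ⟨g, hg⟩)
  refine (measure_mono hsub).trans ((measure_union_le _ _).trans ?_)
  have hz : sqMeasure n
      (⋃ g : Fin 3 → Fin n, {x | Function.Injective g ∧ (fun t => x (g t)) ∈ S3}) = 0 := by
    rw [measure_iUnion_null_iff]
    intro g
    by_cases hg : Function.Injective g
    · simp only [hg, true_and]
      rw [sqMeasure_pre g hg S3_meas, S3_null]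
    · simp [hg]
  rw [hz, add_zero]
  refine (measure_iUnion_fintype_le _ _).trans ?_
  calc _ ≤ ∑ g : Fin 4 → Fin n, (ENNReal.ofReal (2 * r) ^ 2 * ENNReal.ofReal Real.pi) ^ 3 := by
        apply Finset.sum_le_sum
        intro g _
        by_cases hg : Function.Injective g
        · simp only [hg, true_and]
          rw [sqMeasure_pre g hg (S4_meas r)]
          exact S4_bound r
        · simp [hg]
    _ = _ := by simp

theorem plane_subcritical (r : ℕ → ℝ) (hrpos : ∀ n, 0 < r n)
    (hr : Tendsto (fun n : ℕ => r n * (n : ℝ) ^ ((2 : ℝ) / 3)) atTop (nhds 0)) :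
    Tendsto (fun n : ℕ => sqMeasure n {x | ¬ HasCrossing n (r n) x}) atTop (nhds 1) := by
  have hprob : ∀ n, IsProbabilityMeasure (sqMeasure n) := fun n => by
    unfold sqMeasure; infer_instance
  have hbd : ∀ n : ℕ, (n : ENNReal) ^ 4 *
      (ENNReal.ofReal (2 * r n) ^ 2 * ENNReal.ofReal Real.pi) ^ 3 =
      ENNReal.ofReal (64 * Real.pi ^ 3 * (r n * (n : ℝ) ^ ((2 : ℝ) / 3)) ^ 6) := by
    intro n
    have hr0 := (hrpos n).le
    rw [← ENNReal.ofReal_natCast, ← ENNReal.ofReal_pow (by positivity),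
      ← ENNReal.ofReal_pow (by positivity), ← ENNReal.ofReal_mul (by positivity),
      ← ENNReal.ofReal_pow (by positivity), ← ENNReal.ofReal_mul (by positivity)]
    congr 1
    have : ((n : ℝ) ^ ((2 : ℝ) / 3)) ^ 6 = (n : ℝ) ^ 4 := by
      rw [← Real.rpow_natCast, ← Real.rpow_mul (by positivity), ← Real.rpow_natCast]
      norm_num
    rw [mul_pow (r n), this]
    ring
  have hlim : Tendsto (fun n : ℕ =>
      ENNReal.ofReal (64 * Real.pi ^ 3 * (r n * (n : ℝ) ^ ((2 : ℝ) / 3)) ^ 6)) atTop (nhds 0) := by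
    have h := ENNReal.tendsto_ofReal ((hr.pow 6).const_mul (64 * Real.pi ^ 3))
    simpa using h
  have hlow : Tendsto (fun n : ℕ => 1 -
      ENNReal.ofReal (64 * Real.pi ^ 3 * (r n * (n : ℝ) ^ ((2 : ℝ) / 3)) ^ 6)) atTop (nhds 1) := by
    have h := ENNReal.Tendsto.sub (tendsto_const_nhds (x := (1 : ENNReal)) (f := atTop)) hlim
      (Or.inl ENNReal.one_ne_top)
    simpa using h
  refine tendsto_of_tendsto_of_tendsto_of_le_of_le hlow tendsto_const_nhds ?_ ?_
  · intro n
    simp only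
    rw [tsub_le_iff_right, ← hbd]
    calc (1 : ENNReal) = sqMeasure n Set.univ := measure_univ.symm
      _ = sqMeasure n ({x | ¬ HasCrossing n (r n) x} ∪ {x | HasCrossing n (r n) x}) := by
          congr 1; ext x; simp [em']
      _ ≤ _ := measure_union_le _ _
      _ ≤ _ := by gcongr; exact bad_bound n (r n)
  · intro n
    exact prob_le_one
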